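/- Let G be a labeled weighted graph and Q a rooted query tree with label constraint ψ. Let P be a non-complete partial match on rooted prefix S that has at least one complete homomorphic match as a successor, and let u' ∈ ∂S be any boundary node. Then there exists a direct successor P' of P, defined on S ∪ {u'}, that has at least one complete homomorphic match as a successor and satisfies priority(P') = priority(P). (Every popped incomplete partial pattern of priority w has a direct successor with the same priority w.) -/

import Mathlib

open Finset
open scoped Classical

noncomputable section

/-- A finite rooted tree on node type `A`, given by its root and parent function. -/
structure QueryTree (A : Type) where
  root : A
  parent : A → A
  parent_root : parent root = root
  reaches : ∀ v : A, ∃ n : ℕ, parent^[n] v = root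

variable {V L A : Type}

/-- A (complete) homomorphic match of the query tree `Q` (with label constraint `ψ`)
in the labeled graph `G` (with node labeling `φ`). -/
def IsMatch [Fintype A] [DecidableEq A] (G : SimpleGraph V) (φ : V → L)
    (Q : QueryTree A) (ψ : A → L) (lam : A → V) : Prop :=
  (∀ u : A, φ (lam u) = ψ u) ∧
    ∀ u : A, u ≠ Q.root → G.Adj (lam u) (lam (Q.parent u))

/-- Weight of a complete homomorphic match: sum of the edge weights of the images of the
query edges (each non-root query node contributes its parent edge). -/
def matchWeight [Fintype A] [DecidableEq A] (w : Sym2 V → ℝ) (Q : QueryTree A)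
    (lam : A → V) : ℝ :=
  ∑ u ∈ Finset.univ.filter (fun u : A => u ≠ Q.root), w s(lam u, lam (Q.parent u))

/-- The node set of the subtree `Q_u` of `Q` rooted at `u`: all descendants of `u`. -/
def desc (Q : QueryTree A) (u : A) : Set A := {v | ∃ n : ℕ, Q.parent^[n] v = u}

/-- A subtree match at `(u, c)`: a homomorphic match of the subtree `Q_u` in `G`
mapping `u` to `c` (values outside `Q_u` are unconstrained). -/
def IsSubtreeMatch [Fintype A] [DecidableEq A] (G : SimpleGraph V) (φ : V → L)
    (Q : QueryTree A) (ψ : A → L) (u : A) (c : V) (μ : A → V) : Prop :=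
  μ u = c ∧ (∀ v ∈ desc Q u, φ (μ v) = ψ v) ∧
    ∀ v ∈ desc Q u, v ≠ u → G.Adj (μ v) (μ (Q.parent v))

/-- Weight of a subtree match at `u`: sum of `w` over the images of the edges of `Q_u`. -/
def subtreeWeight [Fintype A] [DecidableEq A] (w : Sym2 V → ℝ) (Q : QueryTree A)
    (u : A) (μ : A → V) : ℝ :=
  ∑ v ∈ Finset.univ.filter (fun v : A => v ∈ desc Q u ∧ v ≠ u),
    w s(μ v, μ (Q.parent v))

/-- There exists a subtree match at `(u, c)`. -/
def SubtreeMatchExists [Fintype A] [DecidableEq A] (G : SimpleGraph V) (φ : V → L)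
    (Q : QueryTree A) (ψ : A → L) (u : A) (c : V) : Prop :=
  ∃ μ : A → V, IsSubtreeMatch G φ Q ψ u c μ

/-- Minimum subtree weight `W(u, c)`: the minimum of the weights of all subtree
matches at `(u, c)` (meaningful whenever such a match exists). -/
def minW [Fintype A] [DecidableEq A] (G : SimpleGraph V) (φ : V → L) (w : Sym2 V → ℝ)
    (Q : QueryTree A) (ψ : A → L) (u : A) (c : V) : ℝ :=
  sInf {x : ℝ | ∃ μ : A → V, IsSubtreeMatch G φ Q ψ u c μ ∧ subtreeWeight w Q u μ = x}

/-- A rooted prefix of `Q`: contains the root and is closed under taking parents. -/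
def IsRootedPrefix (Q : QueryTree A) (S : Finset A) : Prop :=
  Q.root ∈ S ∧ ∀ v ∈ S, Q.parent v ∈ S

/-- Boundary `∂S`: the query nodes outside `S` whose parent lies in `S`. -/
def boundary [Fintype A] [DecidableEq A] (Q : QueryTree A) (S : Finset A) : Finset A :=
  Finset.univ.filter (fun u : A => u ∉ S ∧ Q.parent u ∈ S)

/-- A partial match on the rooted prefix `S`: a homomorphic match of the induced
subtree `Q[S]` in `G` (values outside `S` are unconstrained). -/
def IsPartialMatch [Fintype A] [DecidableEq A] (G : SimpleGraph V) (φ : V → L)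
    (Q : QueryTree A) (ψ : A → L) (S : Finset A) (P : A → V) : Prop :=
  (∀ u ∈ S, φ (P u) = ψ u) ∧ ∀ u ∈ S, u ≠ Q.root → G.Adj (P u) (P (Q.parent u))

/-- The set `{ w({c, c'}) + W(u', c') : c' a neighbor of c, φ(c') = ψ(u'),
a subtree match at (u', c') exists }`. -/
def candSet [Fintype A] [DecidableEq A] (G : SimpleGraph V) (φ : V → L) (w : Sym2 V → ℝ)
    (Q : QueryTree A) (ψ : A → L) (c : V) (u' : A) : Set ℝ :=
  {x : ℝ | ∃ c' : V, G.Adj c c' ∧ φ c' = ψ u' ∧ SubtreeMatchExists G φ Q ψ u' c' ∧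
      x = w s(c, c') + minW G φ w Q ψ u' c'}

/-- Priority of a partial match `P` on the rooted prefix `S`. -/
def priorityVal [Fintype A] [DecidableEq A] (G : SimpleGraph V) (φ : V → L)
    (w : Sym2 V → ℝ) (Q : QueryTree A) (ψ : A → L) (S : Finset A) (P : A → V) : ℝ :=
  (∑ u ∈ S.filter (fun u : A => u ≠ Q.root), w s(P u, P (Q.parent u))) +
    ∑ u' ∈ boundary Q S, sInf (candSet G φ w Q ψ (P (Q.parent u')) u')


theorem eq_root_of_iterate_parent_eq_self (Q : QueryTree A) {u : A} {k : ℕ}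
    (h : Q.parent^[k + 1] u = u) : u = Q.root := by
  obtain ⟨n, hn⟩ := Q.reaches u
  have h1 : Q.parent^[(k + 1) * n] u = u := by
    rw [Function.iterate_mul]; exact Function.iterate_fixed h n
  have h2 : (k + 1) * n = k * n + n := by ring
  rw [h2, Function.iterate_add_apply, hn, Function.iterate_fixed Q.parent_root] at h1
  exact h1.symm

theorem self_mem_desc (Q : QueryTree A) (u : A) : u ∈ desc Q u := ⟨0, rfl⟩

theorem parent_mem_desc (Q : QueryTree A) {u x : A} (hx : x ∈ desc Q u) (hne : x ≠ u) :
    Q.parent x ∈ desc Q u := by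
  obtain ⟨n, hn⟩ := hx
  cases n with
  | zero => exact absurd hn hne
  | succ n => exact ⟨n, hn⟩

theorem mem_desc_of_parent_mem_desc (Q : QueryTree A) {u x : A} (hx : Q.parent x ∈ desc Q u) :
    x ∈ desc Q u := by
  obtain ⟨n, hn⟩ := hx
  exact ⟨n + 1, hn⟩

theorem desc_child_subset (Q : QueryTree A) {u v : A} (hv : Q.parent v = u) :
    desc Q v ⊆ desc Q u := by
  rintro x ⟨n, hn⟩
  exact ⟨n + 1, by rw [Function.iterate_succ_apply', hn, hv]⟩

theorem ne_of_mem_desc_child (Q : QueryTree A) {u v x : A} (hu : u ≠ Q.root)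
    (hv : Q.parent v = u) (hx : x ∈ desc Q v) : x ≠ u := by
  rintro rfl
  obtain ⟨n, hn⟩ := hx
  exact hu (eq_root_of_iterate_parent_eq_self Q (k := n)
    (by rw [Function.iterate_succ_apply', hn, hv]))

theorem child_unique (Q : QueryTree A) {u v₁ v₂ x : A} (hu : u ≠ Q.root)
    (h₁ : Q.parent v₁ = u) (h₂ : Q.parent v₂ = u) (hx₁ : x ∈ desc Q v₁) (hx₂ : x ∈ desc Q v₂) :
    v₁ = v₂ := by
  obtain ⟨n, hn⟩ := hx₁
  obtain ⟨m, hm⟩ := hx₂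
  wlog hle : n ≤ m generalizing n m v₁ v₂
  · exact (this h₂ h₁ m hm n hn (by omega)).symm
  obtain ⟨k, rfl⟩ := Nat.exists_eq_add_of_le' hle
  rw [Function.iterate_add_apply, hn] at hm
  cases k with
  | zero => exact hm
  | succ k =>
    exact absurd rfl (ne_of_mem_desc_child Q hu h₂ ⟨k, by rwa [Function.iterate_succ_apply, h₁] at hm⟩)

theorem exists_child_of_mem_desc (Q : QueryTree A) {u x : A} (hx : x ∈ desc Q u) (hne : x ≠ u) :
    ∃ v, Q.parent v = u ∧ x ∈ desc Q v := by
  obtain ⟨n, hn⟩ := hx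
  cases n with
  | zero => exact absurd hn hne
  | succ n => exact ⟨Q.parent^[n] x, (Function.iterate_succ_apply' Q.parent n x).symm.trans hn, n, rfl⟩

theorem iterate_parent_mem (Q : QueryTree A) {S : Finset A} (hS : IsRootedPrefix Q S) {x : A}
    (hx : x ∈ S) (n : ℕ) : Q.parent^[n] x ∈ S := by
  induction n with
  | zero => exact hx
  | succ n ih => rw [Function.iterate_succ_apply']; exact hS.2 _ ih

section MinimumWeights

variable [Fintype A] [DecidableEq A]

/-- The children of `u` in `Q`, for `u` different from the root. -/
def children (Q : QueryTree A) (u : A) : Finset A := Finset.univ.filter fun v => Q.parent v = u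

theorem mem_children (Q : QueryTree A) {u v : A} : v ∈ children Q u ↔ Q.parent v = u := by
  simp [children]

theorem subtreeWeight_eq_sum_children (w : Sym2 V → ℝ) (Q : QueryTree A) {u : A}
    (hu : u ≠ Q.root) (μ : A → V) :
    subtreeWeight w Q u μ = ∑ v ∈ children Q u, (w s(μ u, μ v) + subtreeWeight w Q v μ) := by
  have hset : Finset.univ.filter (fun x : A => x ∈ desc Q u ∧ x ≠ u) =
      (children Q u).biUnion fun v => Finset.univ.filter fun x => x ∈ desc Q v := by
    ext x
    simp only [Finset.mem_filter, Finset.mem_univ, true_and, Finset.mem_biUnion, mem_children]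
    constructor
    · rintro ⟨hx, hne⟩
      exact exists_child_of_mem_desc Q hx hne
    · rintro ⟨v, hv, hx⟩
      exact ⟨desc_child_subset Q hv hx, ne_of_mem_desc_child Q hu hv hx⟩
  rw [subtreeWeight, hset, Finset.sum_biUnion]
  · refine Finset.sum_congr rfl fun v hv => ?_
    have hins : Finset.univ.filter (fun x : A => x ∈ desc Q v) =
        insert v (Finset.univ.filter fun x : A => x ∈ desc Q v ∧ x ≠ v) := by
      ext x
      by_cases hx : x = v
      · simp [hx, self_mem_desc]
      · simp [hx]
    rw [hins, Finset.sum_insert (by simp), (mem_children Q).1 hv, Sym2.eq_swap, subtreeWeight]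
  · intro v₁ h₁ v₂ h₂ hne
    refine Finset.disjoint_left.2 fun x hx₁ hx₂ => hne ?_
    exact child_unique Q hu ((mem_children Q).1 h₁) ((mem_children Q).1 h₂)
      (Finset.mem_filter.1 hx₁).2 (Finset.mem_filter.1 hx₂).2

theorem subtreeWeight_congr (w : Sym2 V → ℝ) (Q : QueryTree A) {u : A} {μ ν : A → V}
    (h : ∀ x ∈ desc Q u, μ x = ν x) : subtreeWeight w Q u μ = subtreeWeight w Q u ν := by
  refine Finset.sum_congr rfl fun x hx => ?_
  obtain ⟨hx, hne⟩ := (Finset.mem_filter.1 hx).2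
  rw [h x hx, h _ (parent_mem_desc Q hx hne)]

variable {G : SimpleGraph V} {φ : V → L} {Q : QueryTree A} {ψ : A → L}

theorem IsSubtreeMatch.child {u v : A} {c : V} {μ : A → V}
    (h : IsSubtreeMatch G φ Q ψ u c μ) (hu : u ≠ Q.root) (hv : Q.parent v = u) :
    IsSubtreeMatch G φ Q ψ v (μ v) μ :=
  ⟨rfl, fun x hx => h.2.1 x (desc_child_subset Q hv hx), fun x hx _ =>
    h.2.2 x (desc_child_subset Q hv hx) (ne_of_mem_desc_child Q hu hv hx)⟩

theorem IsSubtreeMatch.adj_child {u v : A} {c : V} {μ : A → V}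
    (h : IsSubtreeMatch G φ Q ψ u c μ) (hu : u ≠ Q.root) (hv : Q.parent v = u) :
    G.Adj c (μ v) := by
  have hadj := h.2.2 v (desc_child_subset Q hv (self_mem_desc Q v))
    (ne_of_mem_desc_child Q hu hv (self_mem_desc Q v))
  rw [hv, h.1] at hadj
  exact hadj.symm

theorem IsMatch.isSubtreeMatch {lam : A → V} (h : IsMatch G φ Q ψ lam) {u : A}
    (hu : u ≠ Q.root) : IsSubtreeMatch G φ Q ψ u (lam u) lam := by
  refine ⟨rfl, fun x _ => h.1 x, fun x hx _ => h.2 x ?_⟩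
  rintro rfl
  obtain ⟨n, hn⟩ := hx
  exact hu (hn.symm.trans (Function.iterate_fixed Q.parent_root n))

theorem IsMatch.isPartialMatch {lam : A → V} (h : IsMatch G φ Q ψ lam) (S : Finset A) :
    IsPartialMatch G φ Q ψ S lam :=
  ⟨fun u _ => h.1 u, fun u _ hu => h.2 u hu⟩

variable (w : Sym2 V → ℝ)

theorem IsSubtreeMatch.mem_candSet {v : A} {c c' : V} {μ : A → V}
    (h : IsSubtreeMatch G φ Q ψ v c' μ) (hadj : G.Adj c c') :
    w s(c, c') + minW G φ w Q ψ v c' ∈ candSet G φ w Q ψ c v :=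
  ⟨c', hadj, h.1 ▸ h.2.1 v (self_mem_desc Q v), ⟨μ, h⟩, rfl⟩

variable [Fintype V]

theorem minW_le {u : A} {c : V} {μ : A → V} (h : IsSubtreeMatch G φ Q ψ u c μ) :
    minW G φ w Q ψ u c ≤ subtreeWeight w Q u μ := by
  refine csInf_le ?_ ⟨μ, h, rfl⟩
  refine Set.Finite.bddBelow ((Set.finite_range (subtreeWeight w Q u)).subset ?_)
  rintro _ ⟨μ, -, rfl⟩
  exact ⟨μ, rfl⟩

theorem exists_subtreeWeight_eq_minW {u : A} {c : V} (h : SubtreeMatchExists G φ Q ψ u c) :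
    ∃ μ, IsSubtreeMatch G φ Q ψ u c μ ∧ subtreeWeight w Q u μ = minW G φ w Q ψ u c := by
  obtain ⟨μ, hμ⟩ := h
  refine Set.Nonempty.csInf_mem
    (s := {x : ℝ | ∃ μ : A → V, IsSubtreeMatch G φ Q ψ u c μ ∧ subtreeWeight w Q u μ = x})
    ⟨_, μ, hμ, rfl⟩ ((Set.finite_range (subtreeWeight w Q u)).subset ?_)
  rintro _ ⟨μ, -, rfl⟩
  exact ⟨μ, rfl⟩

theorem finite_candSet (c : V) (u : A) : (candSet G φ w Q ψ c u).Finite := by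
  refine (Set.finite_range fun c' => w s(c, c') + minW G φ w Q ψ u c').subset ?_
  rintro _ ⟨c', -, -, -, rfl⟩
  exact ⟨c', rfl⟩

/-- A minimal candidate for `u` next to `c`, realised by a subtree match of minimum weight. -/
theorem exists_sInf_candSet_eq {c : V} {u : A} (h : (candSet G φ w Q ψ c u).Nonempty) :
    ∃ c' μ, G.Adj c c' ∧ IsSubtreeMatch G φ Q ψ u c' μ ∧
      subtreeWeight w Q u μ = minW G φ w Q ψ u c' ∧
      sInf (candSet G φ w Q ψ c u) = w s(c, c') + minW G φ w Q ψ u c' := by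
  obtain ⟨c', hadj, -, hex, heq⟩ := h.csInf_mem (finite_candSet w c u)
  obtain ⟨μ, hμ, hw⟩ := exists_subtreeWeight_eq_minW w hex
  exact ⟨c', μ, hadj, hμ, hw, heq⟩

/-- Bellman recursion for the minimum subtree weight. -/
theorem minW_eq_sum_children {u : A} (hu : u ≠ Q.root) {c : V}
    (hex : SubtreeMatchExists G φ Q ψ u c) :
    minW G φ w Q ψ u c = ∑ v ∈ children Q u, sInf (candSet G φ w Q ψ c v) := by
  apply le_antisymm
  · obtain ⟨μ₀, hμ₀⟩ := hex
    have hchild : ∀ v, Q.parent v = u → ∃ μ : A → V, G.Adj c (μ v) ∧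
        IsSubtreeMatch G φ Q ψ v (μ v) μ ∧
        w s(c, μ v) + subtreeWeight w Q v μ = sInf (candSet G φ w Q ψ c v) := by
      intro v hv
      obtain ⟨c', μ, hadj, hμ, hw, heq⟩ := exists_sInf_candSet_eq w
        ⟨_, (hμ₀.child hu hv).mem_candSet w (hμ₀.adj_child hu hv)⟩
      obtain rfl := hμ.1
      exact ⟨μ, hadj, hμ, by rw [hw, heq]⟩
    have : Nonempty (A → V) := ⟨μ₀⟩
    choose! ν hadj hν hw using hchild
    let μ : A → V := fun x =>
      if h : ∃ v, Q.parent v = u ∧ x ∈ desc Q v then ν h.choose x else c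
    have hμu : μ u = c := dif_neg fun ⟨v, hv, hx⟩ => ne_of_mem_desc_child Q hu hv hx rfl
    have hμν : ∀ v, Q.parent v = u → ∀ x ∈ desc Q v, μ x = ν v x := by
      intro v hv x hx
      have h : ∃ v, Q.parent v = u ∧ x ∈ desc Q v := ⟨v, hv, hx⟩
      have hc : h.choose = v := child_unique Q hu h.choose_spec.1 hv h.choose_spec.2 hx
      rw [show μ x = ν h.choose x from dif_pos h, hc]
    have hμ : IsSubtreeMatch G φ Q ψ u c μ := by
      refine ⟨hμu, fun x hx => ?_, fun x hx hne => ?_⟩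
      · by_cases hxu : x = u
        · rw [hxu, hμu, ← hμ₀.1]
          exact hμ₀.2.1 u (self_mem_desc Q u)
        · obtain ⟨v, hv, hxv⟩ := exists_child_of_mem_desc Q hx hxu
          rw [hμν v hv x hxv]
          exact (hν v hv).2.1 x hxv
      · obtain ⟨v, hv, hxv⟩ := exists_child_of_mem_desc Q hx hne
        rw [hμν v hv x hxv]
        by_cases hxv' : x = v
        · rw [hxv', hv, hμu]
          exact (hadj v hv).symm
        · rw [hμν v hv _ (parent_mem_desc Q hxv hxv')]
          exact (hν v hv).2.2 x hxv hxv'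
    refine (minW_le w hμ).trans_eq ?_
    rw [subtreeWeight_eq_sum_children w Q hu]
    refine Finset.sum_congr rfl fun v hv => ?_
    have hv := (mem_children Q).1 hv
    rw [hμu, hμν v hv v (self_mem_desc Q v), subtreeWeight_congr w Q (hμν v hv), hw v hv]
  · obtain ⟨μ, hμ, hw⟩ := exists_subtreeWeight_eq_minW w hex
    rw [← hw, subtreeWeight_eq_sum_children w Q hu]
    refine Finset.sum_le_sum fun v hv => ?_
    have hv := (mem_children Q).1 hv
    have hle := csInf_le (finite_candSet w c v).bddBelow
      ((hμ.child hu hv).mem_candSet w (hμ.adj_child hu hv))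
    rw [hμ.1]
    linarith [minW_le w (hμ.child hu hv)]

end MinimumWeights

/-- Replacing the part of a complete match inside `Q_u` by another subtree match. -/
theorem IsMatch.replace_subtree [Fintype A] [DecidableEq A] {G : SimpleGraph V} {φ : V → L}
    {Q : QueryTree A} {ψ : A → L} {lam μ : A → V} {u : A} {c : V} (h : IsMatch G φ Q ψ lam)
    (hμ : IsSubtreeMatch G φ Q ψ u c μ) (hu : u ≠ Q.root)
    (hadj : G.Adj (lam (Q.parent u)) c) :
    IsMatch G φ Q ψ fun x => if x ∈ desc Q u then μ x else lam x := by
  refine ⟨fun x => ?_, fun x hx => ?_⟩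
  · by_cases hxu : x ∈ desc Q u
    · simpa only [if_pos hxu] using hμ.2.1 x hxu
    · simpa only [if_neg hxu] using h.1 x
  · by_cases hxu : x ∈ desc Q u
    · by_cases hne : x = u
      · subst hne
        have hp : Q.parent x ∉ desc Q x := fun hmem =>
          ne_of_mem_desc_child Q (u := Q.parent x) (v := x) (fun hr => by
            obtain ⟨n, hn⟩ := hmem
            rw [hr, Function.iterate_fixed Q.parent_root] at hn
            exact hu hn.symm) rfl hmem rfl
        simpa only [if_pos hxu, if_neg hp, hμ.1] using hadj.symm
      · simpa only [if_pos hxu, if_pos (parent_mem_desc Q hxu hne)] using hμ.2.2 x hxu hne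
    · simpa only [if_neg hxu, if_neg (mt (mem_desc_of_parent_mem_desc Q) hxu)] using h.2 x hx

theorem boundary_insert [Fintype A] [DecidableEq A] (Q : QueryTree A) {S : Finset A}
    (hS : IsRootedPrefix Q S) {u : A} (hu : u ∈ boundary Q S) :
    boundary Q (insert u S) = (boundary Q S).erase u ∪ children Q u := by
  have hu' : u ∉ S ∧ Q.parent u ∈ S := by simpa [boundary] using hu
  ext x
  simp only [boundary, Finset.mem_filter, Finset.mem_univ, true_and, Finset.mem_insert,
    Finset.mem_union, Finset.mem_erase, mem_children, not_or]
  constructor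
  · tauto
  · rintro (h | rfl)
    · tauto
    · refine ⟨⟨fun h => hu'.1 ?_, fun h => hu'.1 (hS.2 x h)⟩, Or.inl rfl⟩
      rw [← h] at hu'
      exact hu'.2

/-- a non-complete partial match `P` on `S` having a complete homomorphic
match as a successor has, for any boundary node `u' ∈ ∂S`, a direct successor `P'` on
`S ∪ {u'}` that also has a complete homomorphic match as a successor and satisfies
`priority(P') = priority(P)`. -/
theorem stmt7 [Fintype V] [DecidableEq V] [Fintype A] [DecidableEq A]
    (G : SimpleGraph V) (φ : V → L) (w : Sym2 V → ℝ) (Q : QueryTree A) (ψ : A → L)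
    (S : Finset A) (hS : IsRootedPrefix Q S) (P : A → V)
    (hP : IsPartialMatch G φ Q ψ S P) (hnc : S ≠ Finset.univ)
    (hex : ∃ lam : A → V, IsMatch G φ Q ψ lam ∧ ∀ u ∈ S, lam u = P u)
    (u' : A) (hu' : u' ∈ boundary Q S) :
    ∃ P' : A → V,
      IsPartialMatch G φ Q ψ (insert u' S) P' ∧
      (∀ u ∈ S, P' u = P u) ∧
      (∃ lam : A → V, IsMatch G φ Q ψ lam ∧ ∀ u ∈ insert u' S, lam u = P' u) ∧
      priorityVal G φ w Q ψ (insert u' S) P' = priorityVal G φ w Q ψ S P := by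
  have hu : u' ∉ S ∧ Q.parent u' ∈ S := by simpa [boundary] using hu'
  have hur : u' ≠ Q.root := fun h => hu.1 (h ▸ hS.1)
  obtain ⟨lam, hlam, hlamP⟩ := hex
  have hcand : (candSet G φ w Q ψ (P (Q.parent u')) u').Nonempty := by
    rw [← hlamP _ hu.2]
    exact ⟨_, (hlam.isSubtreeMatch hur).mem_candSet w (hlam.2 u' hur).symm⟩
  obtain ⟨c, μ, hadj, hμ, -, hmin⟩ := exists_sInf_candSet_eq w hcand
  have hmatch := hlam.replace_subtree hμ hur (by rwa [hlamP _ hu.2])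
  set P' : A → V := fun x => if x ∈ desc Q u' then μ x else lam x
  have hP'S : ∀ x ∈ S, P' x = P x := fun x hx =>
    (if_neg fun ⟨n, hn⟩ => hu.1 (hn ▸ iterate_parent_mem Q hS hx n)).trans (hlamP x hx)
  have hP'u : P' u' = c := (if_pos (self_mem_desc Q u')).trans hμ.1
  refine ⟨P', hmatch.isPartialMatch _, hP'S, ⟨P', hmatch, fun _ _ => rfl⟩, ?_⟩
  have hedges : ∑ x ∈ (insert u' S).filter (fun x : A => x ≠ Q.root),
        w s(P' x, P' (Q.parent x)) =
      w s(P (Q.parent u'), c) +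
        ∑ x ∈ S.filter (fun x : A => x ≠ Q.root), w s(P x, P (Q.parent x)) := by
    rw [Finset.filter_insert, if_pos hur, Finset.sum_insert (by simp [hu.1]), hP'u,
      hP'S _ hu.2, Sym2.eq_swap]
    congr 1
    refine Finset.sum_congr rfl fun x hx => ?_
    have hx := (Finset.mem_filter.1 hx).1
    rw [hP'S x hx, hP'S _ (hS.2 x hx)]
  have hdisj : Disjoint ((boundary Q S).erase u') (children Q u') := by
    refine Finset.disjoint_left.2 fun x hx hxc => hu.1 ?_
    rw [← (mem_children Q).1 hxc]
    exact (Finset.mem_filter.1 (Finset.mem_of_mem_erase hx)).2.2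
  have hold : ∑ x ∈ (boundary Q S).erase u',
        sInf (candSet G φ w Q ψ (P' (Q.parent x)) x) =
      ∑ x ∈ (boundary Q S).erase u', sInf (candSet G φ w Q ψ (P (Q.parent x)) x) := by
    refine Finset.sum_congr rfl fun x hx => ?_
    rw [hP'S _ (Finset.mem_filter.1 (Finset.mem_of_mem_erase hx)).2.2]
  have hnew : ∑ x ∈ children Q u', sInf (candSet G φ w Q ψ (P' (Q.parent x)) x) =
      minW G φ w Q ψ u' c := by
    rw [minW_eq_sum_children w hur ⟨μ, hμ⟩]
    refine Finset.sum_congr rfl fun x hx => ?_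
    rw [(mem_children Q).1 hx, hP'u]
  rw [priorityVal, priorityVal, hedges, boundary_insert Q hS hu', Finset.sum_union hdisj, hold,
    hnew, ← Finset.add_sum_erase _ _ hu', hmin]
  ring
end
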